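/- Let E be a finite-dimensional spectral COSEA. Then for a,b∈E, a∘b=b∘a if and only if there exists a context A∈C(E) such that a,b∈E(A). -/

import Mathlib

set_option linter.unusedVariables false

universe u v

theorem prod_eq' {α β : Type*} {p q : α × β} (h1 : p.1 = q.1) (h2 : p.2 = q.2) : p = q :=
  Prod.ext_iff.mpr ⟨h1, h2⟩

/-- A convex sequential effect algebra (COSEA).  The partial sum `⊕` is modelled by a
total operation `oplus` together with a definedness predicate `perp`; all axioms only
constrain `oplus` on pairs satisfying `perp`.  The scalar action is modelled by a total
map `smul : ℝ → E → E`, with axioms imposed for scalars in `[0,1]`. -/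
structure COSEA (E : Type u) where
  zero : E
  one : E
  perp : E → E → Prop
  oplus : E → E → E
  compl : E → E
  smul : ℝ → E → E
  seq : E → E → E
  -- effect algebra axioms
  perp_comm : ∀ a b, perp a b → perp b a
  oplus_comm : ∀ a b, perp a b → oplus a b = oplus b a
  perp_assoc_right : ∀ a b c, perp a b → perp (oplus a b) c → perp b c
  perp_assoc_left : ∀ a b c, perp a b → perp (oplus a b) c → perp a (oplus b c)
  oplus_assoc : ∀ a b c, perp a b → perp (oplus a b) c →
    oplus a (oplus b c) = oplus (oplus a b) c
  perp_compl : ∀ a, perp a (compl a)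
  oplus_compl : ∀ a, oplus a (compl a) = one
  compl_unique : ∀ a b, perp a b → oplus a b = one → b = compl a
  perp_one : ∀ a, perp a one → a = zero
  -- convexity axioms
  smul_smul : ∀ α β a, 0 ≤ α → α ≤ 1 → 0 ≤ β → β ≤ 1 →
    smul α (smul β a) = smul (α * β) a
  perp_smul_self : ∀ α β a, 0 ≤ α → 0 ≤ β → α + β ≤ 1 → perp (smul α a) (smul β a)
  add_smul : ∀ α β a, 0 ≤ α → 0 ≤ β → α + β ≤ 1 →
    smul (α + β) a = oplus (smul α a) (smul β a)
  perp_smul : ∀ lam a b, 0 ≤ lam → lam ≤ 1 → perp a b → perp (smul lam a) (smul lam b)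
  smul_oplus : ∀ lam a b, 0 ≤ lam → lam ≤ 1 → perp a b →
    smul lam (oplus a b) = oplus (smul lam a) (smul lam b)
  one_smul : ∀ a, smul 1 a = a
  -- sequential product axioms
  seq_perp : ∀ a b c, perp b c → perp (seq a b) (seq a c)
  seq_oplus : ∀ a b c, perp b c → seq a (oplus b c) = oplus (seq a b) (seq a c)
  one_seq : ∀ a, seq one a = a
  seq_eq_zero_comm : ∀ a b, seq a b = zero → seq b a = seq a b
  comm_compl : ∀ a b, seq a b = seq b a → seq a (compl b) = seq (compl b) a
  comm_assoc : ∀ a b c, seq a b = seq b a → seq a (seq b c) = seq (seq a b) c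
  comm_seq : ∀ a b c, seq c a = seq a c → seq c b = seq b c →
    seq c (seq a b) = seq (seq a b) c
  comm_oplus : ∀ a b c, seq c a = seq a c → seq c b = seq b c → perp a b →
    seq c (oplus a b) = seq (oplus a b) c
  smul_seq : ∀ lam a b, 0 ≤ lam → lam ≤ 1 → seq (smul lam a) b = smul lam (seq a b)
  seq_smul : ∀ lam a b, 0 ≤ lam → lam ≤ 1 → seq a (smul lam b) = smul lam (seq a b)

/-- `SumList C l s` : the orthogonal sum of the list `l` is defined and equals `s`. -/
inductive COSEA.SumList {E : Type u} (C : COSEA E) : List E → E → Prop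
  | nil : COSEA.SumList C [] C.zero
  | cons {a : E} {l : List E} {s : E} :
      COSEA.SumList C l s → C.perp a s → COSEA.SumList C (a :: l) (C.oplus a s)

namespace COSEA

variable {E : Type u}

/-- `a ≤ b` in the effect-algebra order. -/
def le (C : COSEA E) (a b : E) : Prop := ∃ c, C.perp a c ∧ C.oplus a c = b

/-- `a` is sharp: the greatest lower bound of `a` and `a'` is `0`,
i.e. every common lower bound of `a` and `a'` lies below `0`. -/
def IsSharp (C : COSEA E) (a : E) : Prop :=
  ∀ c, C.le c a → C.le c (C.compl a) → C.le c C.zero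

/-- `a` is a one-dimensional (atomic) sharp element. -/
def IsOneDim (C : COSEA E) (a : E) : Prop :=
  C.IsSharp a ∧ a ≠ C.zero ∧
    ∀ b, C.le b a → ∃ lam : ℝ, 0 ≤ lam ∧ lam ≤ 1 ∧ b = C.smul lam a

/-- A state on a COSEA. -/
def IsState (C : COSEA E) (ω : E → ℝ) : Prop :=
  (∀ a, 0 ≤ ω a ∧ ω a ≤ 1) ∧ ω C.one = 1 ∧
    ∀ a b, C.perp a b → ω (C.oplus a b) = ω a + ω b

/-- A context presented as an injective finite enumeration of one-dimensional
elements summing to `1`. -/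
def IsContextFun (C : COSEA E) {n : ℕ} (a : Fin n → E) : Prop :=
  Function.Injective a ∧ (∀ i, C.IsOneDim (a i)) ∧ C.SumList (List.ofFn a) C.one

/-- A context as a set of effects. -/
def IsContext (C : COSEA E) (A : Set E) : Prop :=
  ∃ (n : ℕ) (a : Fin n → E), C.IsContextFun a ∧ Set.range a = A

/-- `E` is finite-dimensional: there is no infinite sequence of one-dimensional
elements all of whose initial partial orthogonal sums are defined. -/
def FinDim (C : COSEA E) : Prop :=
  ¬ ∃ f : ℕ → E, (∀ i, C.IsOneDim (f i)) ∧
      ∀ n : ℕ, ∃ s, C.SumList ((List.range n).map f) s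

/-- `E` is state-unique. -/
def StateUnique (C : COSEA E) : Prop :=
  ∀ a, C.IsOneDim a → ∃! ω : E → ℝ, C.IsState ω ∧ ω a = 1

/-- `E` is symmetric : `â(b) = b̂(a)` for all one-dimensional `a, b`. -/
def Symm (C : COSEA E) : Prop :=
  ∀ a b ω ρ, C.IsOneDim a → C.IsOneDim b → C.IsState ω → C.IsState ρ →
    ω a = 1 → ρ b = 1 → ω b = ρ a

/-- `b = λ₁ a₁ ⊕ ⋯ ⊕ λₙ aₙ` with all `λ i ∈ [0,1]`. -/
def SpanRep (C : COSEA E) {n : ℕ} (a : Fin n → E) (lam : Fin n → ℝ) (b : E) : Prop :=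
  (∀ i, 0 ≤ lam i ∧ lam i ≤ 1) ∧
    C.SumList (List.ofFn fun i => C.smul (lam i) (a i)) b

/-- `b ∈ E(A)` : `b` has a representation over the context `A`. -/
def InSpan (C : COSEA E) (A : Set E) (b : E) : Prop :=
  ∃ (n : ℕ) (a : Fin n → E) (lam : Fin n → ℝ),
    C.IsContextFun a ∧ Set.range a = A ∧ C.SpanRep a lam b

/-- `E` is spectral. -/
def Spectral (C : COSEA E) : Prop :=
  C.StateUnique ∧ ∀ b, ∃ A, C.IsContext A ∧ C.InSpan A b

/-- The commutant of a subset. -/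
def commutant (C : COSEA E) (F : Set E) : Set E :=
  {b | ∀ a ∈ F, C.seq b a = C.seq a b}

/-- The center `E' = {b : b ∘ a = a ∘ b for all a}`. -/
def center (C : COSEA E) : Set E := C.commutant Set.univ

/-- `E` is a factor: the center consists of the effects `λ 1`, `λ ∈ [0,1]`. -/
def IsFactor (C : COSEA E) : Prop :=
  C.center = {b | ∃ lam : ℝ, 0 ≤ lam ∧ lam ≤ 1 ∧ b = C.smul lam C.one}

/-- Sub-COSEA. -/
def IsSubCOSEA (C : COSEA E) (F : Set E) : Prop :=
  C.zero ∈ F ∧ C.one ∈ F ∧ (∀ a ∈ F, C.compl a ∈ F) ∧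
    (∀ lam : ℝ, 0 ≤ lam → lam ≤ 1 → ∀ a ∈ F, C.smul lam a ∈ F) ∧
    (∀ a ∈ F, ∀ b ∈ F, C.perp a b → C.oplus a b ∈ F) ∧
    (∀ a ∈ F, ∀ b ∈ F, C.seq a b ∈ F)

/-- `a` is a minimal sharp element of `F`. -/
def MinSharp (C : COSEA E) (F : Set E) (a : E) : Prop :=
  a ∈ F ∧ C.IsSharp a ∧ a ≠ C.zero ∧
    ∀ b ∈ F, C.IsSharp b → b ≠ C.zero → C.le b a → b = a

/-- COSEA isomorphism. -/
def IsIso {F : Type u} (C : COSEA E) (D : COSEA F) (φ : E → F) : Prop :=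
  Function.Bijective φ ∧ φ C.one = D.one ∧
    (∀ a b, C.perp a b ↔ D.perp (φ a) (φ b)) ∧
    (∀ a b, C.perp a b → φ (C.oplus a b) = D.oplus (φ a) (φ b)) ∧
    (∀ lam : ℝ, 0 ≤ lam → lam ≤ 1 → ∀ a, φ (C.smul lam a) = D.smul lam (φ a)) ∧
    (∀ a b, φ (C.seq a b) = D.seq (φ a) (φ b))

/-- `lam` is an eigenvalue of `b` : `lam = â(b)` for some eigeneffect `a` of `b`. -/
def IsEigenvalue (C : COSEA E) (b : E) (lam : ℝ) : Prop :=
  ∃ (a : E) (ω : E → ℝ), C.IsOneDim a ∧ C.seq a b = C.seq b a ∧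
    C.IsState ω ∧ ω a = 1 ∧ lam = ω b

/-- The spectrum of `b`. -/
def spectrum (C : COSEA E) (b : E) : Set ℝ := {lam | C.IsEigenvalue b lam}

/-- `c = ⌈a⌉` : `c` is the least sharp element dominating `a`. -/
def IsCeil (C : COSEA E) (a c : E) : Prop :=
  C.IsSharp c ∧ C.le a c ∧ ∀ d, C.IsSharp d → C.le a d → C.le c d

/-- `b` is a pseudo-inverse of `a` with scalar `lam` :
`⌈b⌉ = ⌈a⌉`, `‖b‖ = 1` and `a ∘ b = b ∘ a = lam ⌈a⌉`. -/
def IsPseudoInvWith (C : COSEA E) (a b : E) (lam : ℝ) : Prop :=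
  (∃ ca, C.IsCeil a ca ∧ C.IsCeil b ca ∧
    C.seq a b = C.smul lam ca ∧ C.seq b a = C.smul lam ca) ∧
  IsGreatest (C.spectrum b) 1 ∧ 0 ≤ lam ∧ lam ≤ 1

/-- The conditional probability map `γ_a` (zero functionals are sent to `0`). -/
noncomputable def condProb (C : COSEA E) (a : E) (ω : E → ℝ) : E → ℝ :=
  fun c => if ω a = 0 then 0 else ω (C.seq a c) / ω a

/-- Membership in `Ω̂(E) = Ω(E) ∪ {0}`. -/
def InOmegaHat (C : COSEA E) (ω : E → ℝ) : Prop :=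
  C.IsState ω ∨ ω = fun _ => 0

/-- Direct sum of two COSEAs, with all operations componentwise. -/
def prod {E F : Type u} (C : COSEA E) (D : COSEA F) : COSEA (E × F) where
  zero := (C.zero, D.zero)
  one := (C.one, D.one)
  perp a b := C.perp a.1 b.1 ∧ D.perp a.2 b.2
  oplus a b := (C.oplus a.1 b.1, D.oplus a.2 b.2)
  compl a := (C.compl a.1, D.compl a.2)
  smul lam a := (C.smul lam a.1, D.smul lam a.2)
  seq a b := (C.seq a.1 b.1, D.seq a.2 b.2)
  perp_comm := fun a b h => ⟨C.perp_comm _ _ h.1, D.perp_comm _ _ h.2⟩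
  oplus_comm := fun a b h => prod_eq' (C.oplus_comm _ _ h.1) (D.oplus_comm _ _ h.2)
  perp_assoc_right := fun a b c h1 h2 =>
    ⟨C.perp_assoc_right _ _ _ h1.1 h2.1, D.perp_assoc_right _ _ _ h1.2 h2.2⟩
  perp_assoc_left := fun a b c h1 h2 =>
    ⟨C.perp_assoc_left _ _ _ h1.1 h2.1, D.perp_assoc_left _ _ _ h1.2 h2.2⟩
  oplus_assoc := fun a b c h1 h2 =>
    prod_eq' (C.oplus_assoc _ _ _ h1.1 h2.1) (D.oplus_assoc _ _ _ h1.2 h2.2)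
  perp_compl := fun a => ⟨C.perp_compl _, D.perp_compl _⟩
  oplus_compl := fun a => prod_eq' (C.oplus_compl _) (D.oplus_compl _)
  compl_unique := fun a b h he =>
    prod_eq' (C.compl_unique _ _ h.1 (congrArg Prod.fst he))
      (D.compl_unique _ _ h.2 (congrArg Prod.snd he))
  perp_one := fun a h => prod_eq' (C.perp_one _ h.1) (D.perp_one _ h.2)
  smul_smul := fun α β a h1 h2 h3 h4 =>
    prod_eq' (C.smul_smul _ _ _ h1 h2 h3 h4) (D.smul_smul _ _ _ h1 h2 h3 h4)
  perp_smul_self := fun α β a h1 h2 h3 =>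
    ⟨C.perp_smul_self _ _ _ h1 h2 h3, D.perp_smul_self _ _ _ h1 h2 h3⟩
  add_smul := fun α β a h1 h2 h3 =>
    prod_eq' (C.add_smul _ _ _ h1 h2 h3) (D.add_smul _ _ _ h1 h2 h3)
  perp_smul := fun lam a b h1 h2 h =>
    ⟨C.perp_smul _ _ _ h1 h2 h.1, D.perp_smul _ _ _ h1 h2 h.2⟩
  smul_oplus := fun lam a b h1 h2 h =>
    prod_eq' (C.smul_oplus _ _ _ h1 h2 h.1) (D.smul_oplus _ _ _ h1 h2 h.2)
  one_smul := fun a => prod_eq' (C.one_smul _) (D.one_smul _)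
  seq_perp := fun a b c h => ⟨C.seq_perp _ _ _ h.1, D.seq_perp _ _ _ h.2⟩
  seq_oplus := fun a b c h => prod_eq' (C.seq_oplus _ _ _ h.1) (D.seq_oplus _ _ _ h.2)
  one_seq := fun a => prod_eq' (C.one_seq _) (D.one_seq _)
  seq_eq_zero_comm := fun a b h =>
    prod_eq' (C.seq_eq_zero_comm _ _ (congrArg Prod.fst h))
      (D.seq_eq_zero_comm _ _ (congrArg Prod.snd h))
  comm_compl := fun a b h =>
    prod_eq' (C.comm_compl _ _ (congrArg Prod.fst h))
      (D.comm_compl _ _ (congrArg Prod.snd h))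
  comm_assoc := fun a b c h =>
    prod_eq' (C.comm_assoc _ _ _ (congrArg Prod.fst h))
      (D.comm_assoc _ _ _ (congrArg Prod.snd h))
  comm_seq := fun a b c h1 h2 =>
    prod_eq' (C.comm_seq _ _ _ (congrArg Prod.fst h1) (congrArg Prod.fst h2))
      (D.comm_seq _ _ _ (congrArg Prod.snd h1) (congrArg Prod.snd h2))
  comm_oplus := fun a b c h1 h2 hp =>
    prod_eq' (C.comm_oplus _ _ _ (congrArg Prod.fst h1) (congrArg Prod.fst h2) hp.1)
      (D.comm_oplus _ _ _ (congrArg Prod.snd h1) (congrArg Prod.snd h2) hp.2)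
  smul_seq := fun lam a b h1 h2 =>
    prod_eq' (C.smul_seq _ _ _ h1 h2) (D.smul_seq _ _ _ h1 h2)
  seq_smul := fun lam a b h1 h2 =>
    prod_eq' (C.seq_smul _ _ _ h1 h2) (D.seq_smul _ _ _ h1 h2)

/-- Direct sum of a family of COSEAs, with all operations componentwise. -/
def pi {ι : Type v} {E : ι → Type u} (C : ∀ i, COSEA (E i)) : COSEA (∀ i, E i) where
  zero := fun i => (C i).zero
  one := fun i => (C i).one
  perp a b := ∀ i, (C i).perp (a i) (b i)
  oplus a b := fun i => (C i).oplus (a i) (b i)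
  compl a := fun i => (C i).compl (a i)
  smul lam a := fun i => (C i).smul lam (a i)
  seq a b := fun i => (C i).seq (a i) (b i)
  perp_comm := fun a b h i => (C i).perp_comm _ _ (h i)
  oplus_comm := fun a b h => funext fun i => (C i).oplus_comm _ _ (h i)
  perp_assoc_right := fun a b c h1 h2 i => (C i).perp_assoc_right _ _ _ (h1 i) (h2 i)
  perp_assoc_left := fun a b c h1 h2 i => (C i).perp_assoc_left _ _ _ (h1 i) (h2 i)
  oplus_assoc := fun a b c h1 h2 => funext fun i => (C i).oplus_assoc _ _ _ (h1 i) (h2 i)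
  perp_compl := fun a i => (C i).perp_compl _
  oplus_compl := fun a => funext fun i => (C i).oplus_compl _
  compl_unique := fun a b h he =>
    funext fun i => (C i).compl_unique _ _ (h i) (congrFun he i)
  perp_one := fun a h => funext fun i => (C i).perp_one _ (h i)
  smul_smul := fun α β a h1 h2 h3 h4 =>
    funext fun i => (C i).smul_smul _ _ _ h1 h2 h3 h4
  perp_smul_self := fun α β a h1 h2 h3 i => (C i).perp_smul_self _ _ _ h1 h2 h3
  add_smul := fun α β a h1 h2 h3 => funext fun i => (C i).add_smul _ _ _ h1 h2 h3
  perp_smul := fun lam a b h1 h2 h i => (C i).perp_smul _ _ _ h1 h2 (h i)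
  smul_oplus := fun lam a b h1 h2 h =>
    funext fun i => (C i).smul_oplus _ _ _ h1 h2 (h i)
  one_smul := fun a => funext fun i => (C i).one_smul _
  seq_perp := fun a b c h i => (C i).seq_perp _ _ _ (h i)
  seq_oplus := fun a b c h => funext fun i => (C i).seq_oplus _ _ _ (h i)
  one_seq := fun a => funext fun i => (C i).one_seq _
  seq_eq_zero_comm := fun a b h =>
    funext fun i => (C i).seq_eq_zero_comm _ _ (congrFun h i)
  comm_compl := fun a b h => funext fun i => (C i).comm_compl _ _ (congrFun h i)
  comm_assoc := fun a b c h => funext fun i => (C i).comm_assoc _ _ _ (congrFun h i)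
  comm_seq := fun a b c h1 h2 =>
    funext fun i => (C i).comm_seq _ _ _ (congrFun h1 i) (congrFun h2 i)
  comm_oplus := fun a b c h1 h2 hp =>
    funext fun i => (C i).comm_oplus _ _ _ (congrFun h1 i) (congrFun h2 i) (hp i)
  smul_seq := fun lam a b h1 h2 => funext fun i => (C i).smul_seq _ _ _ h1 h2
  seq_smul := fun lam a b h1 h2 => funext fun i => (C i).seq_smul _ _ _ h1 h2

end COSEA

namespace COSEA

variable {E : Type u}

section EffectAlgebra

variable (C : COSEA E)

theorem compl_compl (a : E) : C.compl (C.compl a) = a :=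
  (C.compl_unique _ _ (C.perp_comm _ _ (C.perp_compl a))
    (by rw [C.oplus_comm _ _ (C.perp_comm _ _ (C.perp_compl a)), C.oplus_compl])).symm

theorem compl_one : C.compl C.one = C.zero :=
  C.perp_one _ (C.perp_comm _ _ (C.perp_compl _))

theorem compl_zero : C.compl C.zero = C.one := by
  rw [← C.compl_one, C.compl_compl]

theorem perp_zero_and_oplus_zero (a : E) : C.perp a C.zero ∧ C.oplus a C.zero = a := by
  have hp := C.perp_comm _ _ (C.perp_compl a)
  have h1 : C.oplus (C.compl a) a = C.one := by rw [C.oplus_comm _ _ hp, C.oplus_compl]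
  have h2 : C.perp (C.oplus (C.compl a) a) C.zero := by
    rw [h1, ← C.compl_one]; exact C.perp_compl _
  refine ⟨C.perp_assoc_right _ _ _ hp h2, ?_⟩
  have h3 := C.compl_unique _ _ (C.perp_assoc_left _ _ _ hp h2)
    (by rw [C.oplus_assoc _ _ _ hp h2, h1]
        have := C.oplus_compl C.one
        rwa [C.compl_one] at this)
  rw [h3, C.compl_compl]

end EffectAlgebra

open Classical in
/-- The partial sum of `C`, totalized: `none` stands for undefined sums. -/
noncomputable def extAdd (C : COSEA E) : Option E → Option E → Option E
  | some a, some b => if C.perp a b then some (C.oplus a b) else none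
  | none, _ => none
  | some _, none => none

theorem extAdd_of_perp (C : COSEA E) {a b : E} (h : C.perp a b) :
    C.extAdd (some a) (some b) = some (C.oplus a b) := if_pos h

theorem extAdd_of_not_perp (C : COSEA E) {a b : E} (h : ¬ C.perp a b) :
    C.extAdd (some a) (some b) = none := if_neg h

theorem none_extAdd (C : COSEA E) (x : Option E) : C.extAdd none x = none := rfl

theorem extAdd_none (C : COSEA E) (x : Option E) : C.extAdd x none = none := by
  cases x <;> rfl

theorem extAdd_comm (C : COSEA E) (x y : Option E) : C.extAdd x y = C.extAdd y x := by
  rcases x with _ | a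
  · rw [none_extAdd, extAdd_none]
  rcases y with _ | b
  · rw [none_extAdd, extAdd_none]
  by_cases h : C.perp a b
  · rw [extAdd_of_perp C h, extAdd_of_perp C (C.perp_comm _ _ h), C.oplus_comm _ _ h]
  · rw [extAdd_of_not_perp C h, extAdd_of_not_perp C fun h' => h (C.perp_comm _ _ h')]

theorem extAdd_assoc (C : COSEA E) (x y z : Option E) :
    C.extAdd (C.extAdd x y) z = C.extAdd x (C.extAdd y z) := by
  rcases x with _ | a
  · simp only [none_extAdd]
  rcases y with _ | b
  · simp only [none_extAdd, extAdd_none]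
  rcases z with _ | c
  · simp only [extAdd_none]
  by_cases h : C.perp a b ∧ C.perp (C.oplus a b) c
  · rw [extAdd_of_perp C h.1, extAdd_of_perp C h.2,
      extAdd_of_perp C (C.perp_assoc_right _ _ _ h.1 h.2),
      extAdd_of_perp C (C.perp_assoc_left _ _ _ h.1 h.2), C.oplus_assoc _ _ _ h.1 h.2]
  · have h' : ¬ (C.perp b c ∧ C.perp a (C.oplus b c)) := by
      rintro ⟨h1, h2⟩
      have h3 := C.perp_comm _ _ h1
      have h4 : C.perp (C.oplus c b) a := by
        rw [C.oplus_comm _ _ h3]; exact C.perp_comm _ _ h2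
      have h5 := C.perp_comm _ _ (C.perp_assoc_right _ _ _ h3 h4)
      refine h ⟨h5, ?_⟩
      rw [C.oplus_comm _ _ h5]
      exact C.perp_comm _ _ (C.perp_assoc_left _ _ _ h3 h4)
    have hl : C.extAdd (C.extAdd (some a) (some b)) (some c) = none := by
      by_cases h1 : C.perp a b
      · rw [extAdd_of_perp C h1, extAdd_of_not_perp C fun h2 => h ⟨h1, h2⟩]
      · rw [extAdd_of_not_perp C h1, none_extAdd]
    have hr : C.extAdd (some a) (C.extAdd (some b) (some c)) = none := by
      by_cases h1 : C.perp b c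
      · rw [extAdd_of_perp C h1, extAdd_of_not_perp C fun h2 => h' ⟨h1, h2⟩]
      · rw [extAdd_of_not_perp C h1, extAdd_none]
    rw [hl, hr]

theorem extAdd_zero (C : COSEA E) (x : Option E) : C.extAdd x (some C.zero) = x := by
  rcases x with _ | a
  · rfl
  · rw [extAdd_of_perp C (C.perp_zero_and_oplus_zero a).1, (C.perp_zero_and_oplus_zero a).2]

/-- The commutative monoid obtained from the effects of `C` by adjoining an absorbing element that
stands for undefined sums. -/
def Ext (_ : COSEA E) : Type u := Option E

/-- The inclusion of the effects into the totalization. -/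
def toExt (C : COSEA E) (a : E) : C.Ext := some a

noncomputable instance (C : COSEA E) : Zero C.Ext := ⟨C.toExt C.zero⟩

noncomputable instance (C : COSEA E) : Add C.Ext := ⟨C.extAdd⟩

noncomputable instance (C : COSEA E) : AddCommMonoid C.Ext where
  add_assoc := C.extAdd_assoc
  zero_add x := (C.extAdd_comm _ _).trans (C.extAdd_zero x)
  add_zero := C.extAdd_zero
  add_comm := C.extAdd_comm
  nsmul := nsmulRec

variable {C : COSEA E}

theorem toExt_zero : C.toExt C.zero = 0 := rfl

theorem toExt_injective : Function.Injective C.toExt := fun _ _ h => Option.some.inj h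

theorem toExt_add_eq_iff {a b c : E} :
    C.toExt a + C.toExt b = C.toExt c ↔ C.perp a b ∧ C.oplus a b = c := by
  change C.extAdd (some a) (some b) = some c ↔ _
  by_cases h : C.perp a b
  · rw [extAdd_of_perp C h, Option.some_inj]
    exact ⟨fun h' => ⟨h, h'⟩, fun h' => h'.2⟩
  · rw [extAdd_of_not_perp C h]
    exact ⟨fun h' => (nomatch h'), fun h' => absurd h'.1 h⟩

theorem toExt_add {a b : E} (h : C.perp a b) :
    C.toExt a + C.toExt b = C.toExt (C.oplus a b) :=
  toExt_add_eq_iff.2 ⟨h, rfl⟩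

theorem exists_toExt_of_add_eq {x y : C.Ext} {s : E} (h : x + y = C.toExt s) :
    ∃ a, x = C.toExt a := by
  rcases x with _ | a
  · cases h
  · exact ⟨a, rfl⟩

theorem toExt_add_compl (a : E) : C.toExt a + C.toExt (C.compl a) = C.toExt C.one :=
  toExt_add_eq_iff.2 ⟨C.perp_compl a, C.oplus_compl a⟩

theorem eq_compl_of_add_eq {a b : E} (h : C.toExt a + C.toExt b = C.toExt C.one) :
    b = C.compl a :=
  have h' := toExt_add_eq_iff.1 h
  C.compl_unique _ _ h'.1 h'.2

theorem add_left_cancel_ext {x y z : C.Ext} {s : E} (h : x + y = C.toExt s)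
    (h' : x + z = C.toExt s) : y = z := by
  obtain ⟨b, rfl⟩ := exists_toExt_of_add_eq ((add_comm y x).trans h)
  obtain ⟨c, rfl⟩ := exists_toExt_of_add_eq ((add_comm z x).trans h')
  have key : ∀ t : E, x + C.toExt t = C.toExt s →
      ∃ d, x + C.toExt (C.compl s) = C.toExt d ∧ t = C.compl d := by
    intro t ht
    have h1 : (x + C.toExt (C.compl s)) + C.toExt t = C.toExt C.one := by
      rw [add_right_comm, ht, toExt_add_compl]
    obtain ⟨d, hd⟩ := exists_toExt_of_add_eq h1
    rw [hd] at h1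
    exact ⟨d, hd, eq_compl_of_add_eq h1⟩
  obtain ⟨d, hd, rfl⟩ := key b h
  obtain ⟨d', hd', rfl⟩ := key c h'
  rw [toExt_injective (hd.symm.trans hd')]

theorem eq_zero_of_add_eq_zero {a b : E} (h : C.toExt a + C.toExt b = 0) : a = C.zero := by
  have h1 : (C.toExt a + C.toExt C.one) + C.toExt b = C.toExt C.one := by
    rw [add_right_comm, h, zero_add]
  obtain ⟨d, hd⟩ := exists_toExt_of_add_eq h1
  exact C.perp_one _ (toExt_add_eq_iff.1 hd).1

theorem le_iff {a b : E} : C.le a b ↔ ∃ c, C.toExt a + C.toExt c = C.toExt b := by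
  simp only [toExt_add_eq_iff]; rfl

section Sums

variable {ι : Type*}

theorem exists_toExt_of_sum_eq {s : Finset ι} {x : ι → C.Ext} {a : E}
    (h : ∑ i ∈ s, x i = C.toExt a) {j : ι} (hj : j ∈ s) :
    ∃ b, x j + C.toExt b = C.toExt a := by
  classical
  rw [← Finset.add_sum_erase _ _ hj] at h
  obtain ⟨b, hb⟩ := exists_toExt_of_add_eq ((add_comm _ _).trans h)
  exact ⟨b, hb ▸ h⟩

theorem le_of_sum_eq {s : Finset ι} {x : ι → E} {a : E}
    (h : ∑ i ∈ s, C.toExt (x i) = C.toExt a) {j : ι} (hj : j ∈ s) : C.le (x j) a :=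
  le_iff.2 (exists_toExt_of_sum_eq h hj)

theorem sumList_iff {l : List E} {s : E} :
    C.SumList l s ↔ (l.map C.toExt).sum = C.toExt s := by
  constructor
  · intro h
    induction h with
    | nil => rfl
    | cons h hp ih => rw [List.map_cons, List.sum_cons, ih, toExt_add hp]
  · induction l generalizing s with
    | nil => intro h; rw [← toExt_injective h]; exact SumList.nil
    | cons a l ih =>
      intro h
      rw [List.map_cons, List.sum_cons] at h
      obtain ⟨t, ht⟩ := exists_toExt_of_add_eq ((add_comm _ _).trans h)
      rw [ht] at h
      obtain ⟨hp, rfl⟩ := toExt_add_eq_iff.1 h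
      exact SumList.cons (ih ht) hp

theorem sumList_ofFn_iff {n : ℕ} {x : Fin n → E} {s : E} :
    C.SumList (List.ofFn x) s ↔ ∑ i, C.toExt (x i) = C.toExt s := by
  rw [sumList_iff, List.map_ofFn, List.sum_ofFn]; rfl

/-- `φ` preserves sums that are defined. -/
def IsAdditive (C : COSEA E) (φ : E → E) : Prop :=
  ∀ a b, C.perp a b → C.perp (φ a) (φ b) ∧ φ (C.oplus a b) = C.oplus (φ a) (φ b)

theorem IsAdditive.add {φ : E → E} (hφ : C.IsAdditive φ) {a b c : E}
    (h : C.toExt a + C.toExt b = C.toExt c) :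
    C.toExt (φ a) + C.toExt (φ b) = C.toExt (φ c) := by
  obtain ⟨hp, rfl⟩ := toExt_add_eq_iff.1 h
  rw [toExt_add (hφ a b hp).1, (hφ a b hp).2]

theorem IsAdditive.map_zero {φ : E → E} (hφ : C.IsAdditive φ) : φ C.zero = C.zero := by
  have h := hφ.add (a := C.zero) (b := C.zero) (c := C.zero) (by rw [toExt_zero, add_zero])
  exact toExt_injective (add_left_cancel_ext h (by rw [toExt_zero, add_zero]))

theorem IsAdditive.sum {φ : E → E} (hφ : C.IsAdditive φ) {s : Finset ι} {x : ι → E} {a : E}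
    (h : ∑ i ∈ s, C.toExt (x i) = C.toExt a) :
    ∑ i ∈ s, C.toExt (φ (x i)) = C.toExt (φ a) := by
  classical
  induction s using Finset.induction_on generalizing a with
  | empty =>
    rw [← toExt_injective (show C.toExt C.zero = C.toExt a from h), hφ.map_zero]; rfl
  | insert j s hj ih =>
    rw [Finset.sum_insert hj] at h ⊢
    obtain ⟨t, ht⟩ := exists_toExt_of_add_eq ((add_comm _ _).trans h)
    rw [ih ht]
    rw [ht] at h
    exact hφ.add h

theorem isAdditive_seq (a : E) : C.IsAdditive (C.seq a) :=
  fun b c h => ⟨C.seq_perp a b c h, C.seq_oplus a b c h⟩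

theorem isAdditive_smul {t : ℝ} (h0 : 0 ≤ t) (h1 : t ≤ 1) : C.IsAdditive (C.smul t) :=
  fun b c h => ⟨C.perp_smul t b c h0 h1 h, C.smul_oplus t b c h0 h1 h⟩

theorem exists_sum_eq_of_le {s : Finset ι} {x y : ι → E} {a : E}
    (hxy : ∀ i ∈ s, C.le (x i) (y i)) (h : ∑ i ∈ s, C.toExt (y i) = C.toExt a) :
    ∃ b, ∑ i ∈ s, C.toExt (x i) = C.toExt b := by
  have h' : ∀ i, ∃ z, i ∈ s → C.toExt (x i) + C.toExt z = C.toExt (y i) := by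
    intro i
    by_cases hi : i ∈ s
    · obtain ⟨z, hz⟩ := le_iff.1 (hxy i hi)
      exact ⟨z, fun _ => hz⟩
    · exact ⟨C.zero, fun h => absurd h hi⟩
  choose z hz using h'
  rw [← Finset.sum_congr rfl hz, Finset.sum_add_distrib] at h
  exact exists_toExt_of_add_eq h

end Sums

section Scalars

theorem toExt_smul_add {s t : ℝ} (hs : 0 ≤ s) (ht : 0 ≤ t) (hst : s + t ≤ 1) (a : E) :
    C.toExt (C.smul s a) + C.toExt (C.smul t a) = C.toExt (C.smul (s + t) a) := by
  rw [toExt_add (C.perp_smul_self s t a hs ht hst), C.add_smul s t a hs ht hst]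

theorem zero_smul (a : E) : C.smul 0 a = C.zero := by
  have h := toExt_smul_add (C := C) le_rfl le_rfl (by norm_num) a
  rw [add_zero] at h
  exact toExt_injective (add_left_cancel_ext h (by rw [toExt_zero, add_zero]))

theorem smul_half_add_self (a : E) :
    C.toExt (C.smul (1 / 2) a) + C.toExt (C.smul (1 / 2) a) = C.toExt a := by
  rw [toExt_smul_add (by norm_num) (by norm_num) (by norm_num)]
  norm_num [C.one_smul]

theorem smul_half_injective : Function.Injective (C.smul (1 / 2)) := by
  intro a b h
  apply toExt_injective
  rw [← smul_half_add_self a, ← smul_half_add_self b, h]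

theorem smul_half_pow_injective (n : ℕ) : Function.Injective (C.smul ((1 / 2) ^ n)) := by
  induction n with
  | zero => intro a b h; simpa [C.one_smul] using h
  | succ n ih =>
    intro a b h
    apply smul_half_injective
    apply ih
    have h1 : ((1 : ℝ) / 2) ^ n ≤ 1 := pow_le_one₀ (by norm_num) (by norm_num)
    rw [C.smul_smul _ _ _ (by positivity) h1 (by norm_num) (by norm_num),
      C.smul_smul _ _ _ (by positivity) h1 (by norm_num) (by norm_num), ← pow_succ]
    exact h

theorem smul_injective {t : ℝ} (h0 : 0 < t) (h1 : t ≤ 1) : Function.Injective (C.smul t) := by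
  intro a b h
  obtain ⟨n, hn⟩ := exists_pow_lt_of_lt_one h0 (by norm_num : (1 : ℝ) / 2 < 1)
  apply smul_half_pow_injective n
  have e : ((1 : ℝ) / 2) ^ n = ((1 / 2) ^ n / t) * t := by field_simp
  have h2 : ((1 : ℝ) / 2) ^ n / t ≤ 1 := (div_le_one h0).2 hn.le
  rw [e, ← C.smul_smul _ _ _ (by positivity) h2 h0.le h1, h,
    C.smul_smul _ _ _ (by positivity) h2 h0.le h1]

theorem eq_zero_of_smul_eq_zero {t : ℝ} (h0 : 0 < t) (h1 : t ≤ 1) {a : E}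
    (h : C.smul t a = C.zero) : a = C.zero :=
  smul_injective h0 h1 (h.trans (isAdditive_smul h0.le h1).map_zero.symm)

theorem smul_le {t : ℝ} (h0 : 0 ≤ t) (h1 : t ≤ 1) (a : E) : C.le (C.smul t a) a := by
  refine le_iff.2 ⟨C.smul (1 - t) a, ?_⟩
  rw [toExt_smul_add h0 (by linarith) (by linarith), add_sub_cancel, C.one_smul]

end Scalars

section Product

theorem seq_zero (a : E) : C.seq a C.zero = C.zero := (isAdditive_seq a).map_zero

theorem zero_seq (a : E) : C.seq C.zero a = C.zero :=
  (C.seq_eq_zero_comm _ _ (seq_zero a)).trans (seq_zero a)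

theorem seq_one (a : E) : C.seq a C.one = a := by
  have h := C.comm_compl a C.zero (by rw [seq_zero, zero_seq])
  rwa [C.compl_zero, C.one_seq] at h

theorem seq_comm_one (a : E) : C.seq a C.one = C.seq C.one a := by
  rw [seq_one, C.one_seq]

theorem seq_add_seq_compl (a b : E) :
    C.toExt (C.seq a b) + C.toExt (C.seq a (C.compl b)) = C.toExt a := by
  rw [(isAdditive_seq a).add (toExt_add_compl b), seq_one]

theorem seq_le (a b : E) : C.le (C.seq a b) a := le_iff.2 ⟨_, seq_add_seq_compl a b⟩

theorem eq_zero_of_le_zero {a : E} (h : C.le a C.zero) : a = C.zero := by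
  obtain ⟨c, hc⟩ := le_iff.1 h
  exact eq_zero_of_add_eq_zero hc

theorem seq_compl_eq_zero_of_seq_self {a : E} (h : C.seq a a = a) :
    C.seq a (C.compl a) = C.zero := by
  have h1 := seq_add_seq_compl (C := C) a a
  rw [h] at h1
  exact toExt_injective (add_left_cancel_ext h1 (by rw [toExt_zero, add_zero]))

theorem IsSharp.seq_self {a : E} (h : C.IsSharp a) : C.seq a a = a := by
  have h1 : C.seq a (C.compl a) = C.zero := by
    apply eq_zero_of_le_zero
    refine h _ (seq_le _ _) ?_
    rw [C.comm_compl a a rfl]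
    exact seq_le _ _
  have h2 := seq_add_seq_compl (C := C) a a
  rw [h1, toExt_zero, add_zero] at h2
  exact toExt_injective h2

theorem seq_eq_zero_of_le {a b c : E} (h : C.le b c) (hc : C.seq a c = C.zero) :
    C.seq a b = C.zero := by
  obtain ⟨d, hd⟩ := le_iff.1 h
  have h1 := (isAdditive_seq a).add hd
  rw [hc] at h1
  exact eq_zero_of_add_eq_zero h1

theorem comm_smul {a b : E} {t : ℝ} (h0 : 0 ≤ t) (h1 : t ≤ 1) (h : C.seq a b = C.seq b a) :
    C.seq a (C.smul t b) = C.seq (C.smul t b) a := by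
  rw [C.seq_smul t a b h0 h1, C.smul_seq t b a h0 h1, h]

theorem comm_sum {ι : Type*} {s : Finset ι} {x : ι → E} {a b : E}
    (hx : ∀ i ∈ s, C.seq a (x i) = C.seq (x i) a)
    (h : ∑ i ∈ s, C.toExt (x i) = C.toExt b) : C.seq a b = C.seq b a := by
  classical
  induction s using Finset.induction_on generalizing b with
  | empty =>
    rw [← toExt_injective (show C.toExt C.zero = C.toExt b from h), seq_zero, zero_seq]
  | insert j s hj ih =>
    rw [Finset.sum_insert hj] at h
    obtain ⟨t, ht⟩ := exists_toExt_of_add_eq ((add_comm _ _).trans h)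
    rw [ht] at h
    obtain ⟨hp, rfl⟩ := toExt_add_eq_iff.1 h
    exact C.comm_oplus _ _ _ (hx j (Finset.mem_insert_self _ _))
      (ih (fun i hi => hx i (Finset.mem_insert_of_mem hi)) ht) hp

end Product

section Frames

variable {ι : Type*} [Fintype ι]

/-- A finite family of one-dimensional effects with sum `1`. -/
def IsFrame (C : COSEA E) (c : ι → E) : Prop :=
  (∀ i, C.IsOneDim (c i)) ∧ ∑ i, C.toExt (c i) = C.toExt C.one

/-- `x` is the combination of the family `c` with coefficients `f i ∈ [0,1]`. -/
def IsCombo (C : COSEA E) (c : ι → E) (f : ι → ℝ) (x : E) : Prop :=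
  (∀ i, 0 ≤ f i ∧ f i ≤ 1) ∧ ∑ i, C.toExt (C.smul (f i) (c i)) = C.toExt x

variable {c : ι → E}

theorem IsFrame.seq_self (hc : C.IsFrame c) (i : ι) : C.seq (c i) (c i) = c i :=
  (hc.1 i).1.seq_self

theorem IsFrame.seq_eq_zero (hc : C.IsFrame c) {i j : ι} (hij : i ≠ j) :
    C.seq (c i) (c j) = C.zero := by
  classical
  have h := (isAdditive_seq (C := C) (c i)).sum hc.2
  rw [seq_one, ← Finset.add_sum_erase _ _ (Finset.mem_univ i), hc.seq_self] at h
  have h2 : ∑ j ∈ Finset.univ.erase i, C.toExt (C.seq (c i) (c j)) = C.toExt C.zero :=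
    add_left_cancel_ext h (by rw [toExt_zero, add_zero])
  exact eq_zero_of_le_zero (le_of_sum_eq h2 (Finset.mem_erase.2 ⟨hij.symm, Finset.mem_univ j⟩))

theorem IsFrame.injective (hc : C.IsFrame c) : Function.Injective c := by
  intro i j h
  by_contra hij
  have h1 := hc.seq_eq_zero hij
  rw [← h, hc.seq_self] at h1
  exact (hc.1 i).2.1 h1

theorem IsFrame.comm (hc : C.IsFrame c) (i j : ι) :
    C.seq (c i) (c j) = C.seq (c j) (c i) := by
  by_cases h : i = j
  · rw [h]
  · rw [hc.seq_eq_zero h, hc.seq_eq_zero (Ne.symm h)]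

theorem IsFrame.exists_combo (hc : C.IsFrame c) {f : ι → ℝ} (hf : ∀ i, 0 ≤ f i ∧ f i ≤ 1) :
    ∃ x, C.IsCombo c f x := by
  obtain ⟨x, hx⟩ := exists_sum_eq_of_le (x := fun i => C.smul (f i) (c i))
    (fun i _ => smul_le (hf i).1 (hf i).2 (c i)) hc.2
  exact ⟨x, hf, hx⟩

theorem IsFrame.seq_combo (hc : C.IsFrame c) {f : ι → ℝ} {x : E} (hx : C.IsCombo c f x)
    (i : ι) : C.seq (c i) x = C.smul (f i) (c i) := by
  apply toExt_injective
  rw [← (isAdditive_seq (c i)).sum hx.2, Finset.sum_eq_single i]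
  · rw [C.seq_smul _ _ _ (hx.1 i).1 (hx.1 i).2, hc.seq_self]
  · intro j _ hj
    rw [C.seq_smul _ _ _ (hx.1 j).1 (hx.1 j).2, hc.seq_eq_zero hj.symm,
      (isAdditive_smul (hx.1 j).1 (hx.1 j).2).map_zero, toExt_zero]
  · intro h
    exact absurd (Finset.mem_univ i) h

theorem IsFrame.combo_seq (hc : C.IsFrame c) {f : ι → ℝ} {x : E} (hx : C.IsCombo c f x)
    (i : ι) : C.seq x (c i) = C.smul (f i) (c i) := by
  rw [← hc.seq_combo hx i]
  exact (comm_sum (fun j _ => comm_smul (hx.1 j).1 (hx.1 j).2 (hc.comm i j)) hx.2).symm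

theorem IsFrame.combo_mul (hc : C.IsFrame c) {f g : ι → ℝ} {x y : E} (hx : C.IsCombo c f x)
    (hy : C.IsCombo c g y) : C.IsCombo c (fun i => f i * g i) (C.seq x y) := by
  refine ⟨fun i => ⟨mul_nonneg (hx.1 i).1 (hy.1 i).1,
    mul_le_one₀ (hx.1 i).2 (hy.1 i).1 (hy.1 i).2⟩, ?_⟩
  rw [← (isAdditive_seq x).sum hy.2]
  refine Finset.sum_congr rfl fun i _ => ?_
  rw [C.seq_smul _ _ _ (hy.1 i).1 (hy.1 i).2, hc.combo_seq hx,
    C.smul_smul _ _ _ (hy.1 i).1 (hy.1 i).2 (hx.1 i).1 (hx.1 i).2, mul_comm]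

theorem IsCombo.unique {f : ι → ℝ} {x y : E} (hx : C.IsCombo c f x) (hy : C.IsCombo c f y) :
    x = y :=
  toExt_injective (hx.2.symm.trans hy.2)

theorem IsCombo.compl (hc : C.IsFrame c) {f : ι → ℝ} {x : E} (hx : C.IsCombo c f x) :
    C.IsCombo c (fun i => 1 - f i) (C.compl x) := by
  obtain ⟨y, hy⟩ := hc.exists_combo (f := fun i => 1 - f i)
    (fun i => ⟨by linarith [(hx.1 i).2], by linarith [(hx.1 i).1]⟩)
  have : C.toExt x + C.toExt y = C.toExt C.one := by
    rw [← hx.2, ← hy.2, ← Finset.sum_add_distrib, ← hc.2]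
    refine Finset.sum_congr rfl fun i _ => ?_
    rw [toExt_smul_add (hx.1 i).1 (hy.1 i).1 (by simp), add_sub_cancel, C.one_smul]
  rwa [← eq_compl_of_add_eq this]

theorem IsCombo.smul {f : ι → ℝ} {x : E} (hx : C.IsCombo c f x) {t : ℝ} (h0 : 0 ≤ t)
    (h1 : t ≤ 1) : C.IsCombo c (fun i => t * f i) (C.smul t x) := by
  refine ⟨fun i => ⟨mul_nonneg h0 (hx.1 i).1, mul_le_one₀ h1 (hx.1 i).1 (hx.1 i).2⟩, ?_⟩
  rw [← (isAdditive_smul h0 h1).sum hx.2]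
  refine Finset.sum_congr rfl fun i _ => ?_
  rw [C.smul_smul _ _ _ h0 h1 (hx.1 i).1 (hx.1 i).2]

theorem IsFrame.combo_one (hc : C.IsFrame c) : C.IsCombo c (fun _ => 1) C.one := by
  refine ⟨fun _ => by norm_num, ?_⟩
  simp only [C.one_smul]
  exact hc.2

end Frames

section Commutant

variable {ι : Type*} [Fintype ι] {c : ι → E} {a : E}

/-- The combination of the family `c` with coefficients `f` exists and commutes with `a`. -/
def ComboCommutes (C : COSEA E) (c : ι → E) (a : E) (f : ι → ℝ) : Prop :=
  ∃ x, C.IsCombo c f x ∧ C.seq a x = C.seq x a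

theorem ComboCommutes.mem {f : ι → ℝ} (hf : C.ComboCommutes c a f) (i : ι) :
    0 ≤ f i ∧ f i ≤ 1 := by
  obtain ⟨x, hx, -⟩ := hf
  exact hx.1 i

theorem ComboCommutes.const (hc : C.IsFrame c) {t : ℝ} (h0 : 0 ≤ t) (h1 : t ≤ 1) :
    C.ComboCommutes c a (fun _ => t) := by
  have h := hc.combo_one.smul h0 h1
  simp only [mul_one] at h
  exact ⟨_, h, comm_smul h0 h1 (seq_comm_one a)⟩

theorem ComboCommutes.compl (hc : C.IsFrame c) {f : ι → ℝ} (hf : C.ComboCommutes c a f) :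
    C.ComboCommutes c a (fun i => 1 - f i) := by
  obtain ⟨x, hx, hax⟩ := hf
  exact ⟨_, hx.compl hc, C.comm_compl _ _ hax⟩

theorem ComboCommutes.smul {f : ι → ℝ} (hf : C.ComboCommutes c a f) {t : ℝ}
    (h0 : 0 ≤ t) (h1 : t ≤ 1) : C.ComboCommutes c a (fun i => t * f i) := by
  obtain ⟨x, hx, hax⟩ := hf
  exact ⟨_, hx.smul h0 h1, comm_smul h0 h1 hax⟩

theorem ComboCommutes.mul (hc : C.IsFrame c) {f g : ι → ℝ} (hf : C.ComboCommutes c a f)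
    (hg : C.ComboCommutes c a g) : C.ComboCommutes c a (fun i => f i * g i) := by
  obtain ⟨x, hx, hax⟩ := hf
  obtain ⟨y, hy, hay⟩ := hg
  exact ⟨_, hc.combo_mul hx hy, C.comm_seq _ _ _ hax hay⟩

theorem ComboCommutes.add {f g : ι → ℝ} (hc : C.IsFrame c) (hf : C.ComboCommutes c a f)
    (hg : C.ComboCommutes c a g) (hfg : ∀ i, f i + g i ≤ 1) :
    C.ComboCommutes c a (fun i => f i + g i) := by
  obtain ⟨x, hx, hax⟩ := hf
  obtain ⟨y, hy, hay⟩ := hg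
  obtain ⟨z, hz⟩ := hc.exists_combo (f := fun i => f i + g i)
    (fun i => ⟨add_nonneg (hx.1 i).1 (hy.1 i).1, hfg i⟩)
  have h : C.toExt x + C.toExt y = C.toExt z := by
    rw [← hx.2, ← hy.2, ← hz.2, ← Finset.sum_add_distrib]
    exact Finset.sum_congr rfl fun i _ => toExt_smul_add (hx.1 i).1 (hy.1 i).1 (hfg i) _
  refine ⟨z, hz, ?_⟩
  obtain ⟨hp, rfl⟩ := toExt_add_eq_iff.1 h
  exact C.comm_oplus _ _ _ hax hay hp

theorem ComboCommutes.sub {f g : ι → ℝ} (hc : C.IsFrame c) (hf : C.ComboCommutes c a f)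
    (hg : C.ComboCommutes c a g) (hgf : ∀ i, g i ≤ f i) :
    C.ComboCommutes c a (fun i => f i - g i) := by
  have h := ((hf.compl hc).add hc hg fun i => by linarith [hgf i]).compl hc
  convert h using 2 with i
  ring

theorem ComboCommutes.of_smul {f : ι → ℝ} (hc : C.IsFrame c) (hf : ∀ i, 0 ≤ f i ∧ f i ≤ 1)
    {t : ℝ} (h0 : 0 < t) (h1 : t ≤ 1) (htf : C.ComboCommutes c a (fun i => t * f i)) :
    C.ComboCommutes c a f := by
  obtain ⟨x, hx⟩ := hc.exists_combo hf
  obtain ⟨y, hy, hay⟩ := htf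
  refine ⟨x, hx, smul_injective (C := C) h0 h1 ?_⟩
  obtain rfl := hy.unique (hx.smul h0.le h1)
  rwa [C.seq_smul _ _ _ h0.le h1, C.smul_seq _ _ _ h0.le h1] at hay

theorem ComboCommutes.sq_sub_const {f : ι → ℝ} (hc : C.IsFrame c)
    (hf : C.ComboCommutes c a f) {t : ℝ} (h0 : 0 ≤ t) (h1 : t ≤ 1) :
    C.ComboCommutes c a (fun i => (f i - t) ^ 2 / 2) := by
  have h2 := ((hf.mul hc hf).smul (t := 1 / 2) (by norm_num) (by norm_num)).add hc
    (ComboCommutes.const hc (t := t * t / 2) (by positivity) (by nlinarith))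
    (fun i => by nlinarith [hf.mem i])
  have h3 := h2.sub hc (hf.smul h0 h1) (fun i => by nlinarith [sq_nonneg (f i - t)])
  convert h3 using 2 with i
  ring

open Classical in
theorem ComboCommutes.levelSet {f : ι → ℝ} (hc : C.IsFrame c) (hf : C.ComboCommutes c a f)
    {t : ℝ} (ht : t ∈ Finset.univ.image f) :
    C.ComboCommutes c a (fun i => if f i = t then 1 else 0) := by
  have hK : ∀ s ∈ Finset.univ.image f, 0 ≤ s ∧ s ≤ 1 := by
    intro s hs
    obtain ⟨i, -, rfl⟩ := Finset.mem_image.1 hs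
    exact hf.mem i
  have hprod : ∀ K : Finset ℝ, K ⊆ Finset.univ.image f →
      C.ComboCommutes c a (fun i => ∏ s ∈ K, (f i - s) ^ 2 / 2) := by
    intro K
    induction K using Finset.induction_on with
    | empty => intro _; simpa using ComboCommutes.const hc (a := a) zero_le_one le_rfl
    | insert s K hs ih =>
      intro hsub
      have hs' := hK s (hsub (Finset.mem_insert_self _ _))
      simp only [Finset.prod_insert hs]
      exact (hf.sq_sub_const hc hs'.1 hs'.2).mul hc
        (ih fun r hr => hsub (Finset.mem_insert_of_mem hr))
  set K := (Finset.univ.image f).erase t with hKdef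
  have h := hprod K (Finset.erase_subset _ _)
  have hpos : 0 < ∏ s ∈ K, (t - s) ^ 2 / 2 := by
    refine Finset.prod_pos fun s hs => ?_
    have : t - s ≠ 0 := sub_ne_zero.2 (Finset.ne_of_mem_erase hs).symm
    positivity
  have hle : ∏ s ∈ K, (t - s) ^ 2 / 2 ≤ 1 := by
    obtain ⟨i, -, rfl⟩ := Finset.mem_image.1 ht
    exact (h.mem i).2
  refine ComboCommutes.of_smul hc (fun i => by split_ifs <;> norm_num) hpos hle ?_
  convert h using 2 with i
  split_ifs with hi
  · rw [hi, mul_one]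
  · rw [mul_zero]
    refine (Finset.prod_eq_zero (i := f i) ?_ (by simp)).symm
    exact Finset.mem_erase.2 ⟨hi, Finset.mem_image_of_mem f (Finset.mem_univ i)⟩

end Commutant

section Spectral

theorem Spectral.exists_frame (h : C.Spectral) (b : E) :
    ∃ (n : ℕ) (c : Fin n → E) (f : Fin n → ℝ), C.IsFrame c ∧ C.IsCombo c f b := by
  obtain ⟨A, -, n, c, f, hc, -, hf⟩ := h.2 b
  exact ⟨n, c, f, ⟨hc.2.1, sumList_ofFn_iff.1 hc.2.2⟩, hf.1, sumList_ofFn_iff.1 hf.2⟩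

/-- Spectral decomposition of an effect relative to an idempotent effect dominating it. -/
theorem Spectral.exists_frame_of_le (h : C.Spectral) {p x : E} (hp : C.seq p p = p)
    (hx : C.le x p) :
    ∃ (n : ℕ) (c : Fin n → E) (s : Finset (Fin n)) (g : Fin n → ℝ),
      (∀ i ∈ s, C.IsOneDim (c i) ∧ 0 ≤ g i ∧ g i ≤ 1) ∧
      ∑ i ∈ s, C.toExt (c i) = C.toExt p ∧
      ∑ i ∈ s, C.toExt (C.smul (g i) (c i)) = C.toExt x := by
  classical
  obtain ⟨z, hz⟩ := le_iff.1 hx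
  have hhalf : C.IsAdditive (C.smul (1 / 2)) := isAdditive_smul (by norm_num) (by norm_num)
  have hpz := hhalf.add hz
  have hyp : (C.toExt (C.smul (1 / 2) x) + C.toExt (C.smul (1 / 2) p)) +
      C.toExt (C.smul (1 / 2) z) = C.toExt p := by
    rw [add_right_comm, hpz, smul_half_add_self]
  obtain ⟨y, hy⟩ := exists_toExt_of_add_eq hyp
  rw [hy] at hyp
  obtain ⟨n, c, f, hc, hf⟩ := h.exists_frame y
  have hpp := seq_compl_eq_zero_of_seq_self hp
  have hpp' : C.seq (C.compl p) p = C.zero := (C.seq_eq_zero_comm _ _ hpp).trans hpp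
  have hy0 : C.seq (C.compl p) y = C.zero := seq_eq_zero_of_le (le_iff.2 ⟨_, hyp⟩) hpp'
  have hsupp : ∀ i, f i ≠ 0 → C.seq p (c i) = c i ∧ C.seq (c i) p = c i := by
    intro i hi
    have h0 : C.seq (C.compl p) (c i) = C.zero := by
      apply eq_zero_of_smul_eq_zero (lt_of_le_of_ne (hf.1 i).1 hi.symm) (hf.1 i).2
      rw [← C.seq_smul _ _ _ (hf.1 i).1 (hf.1 i).2]
      exact seq_eq_zero_of_le (le_of_sum_eq hf.2 (Finset.mem_univ i)) hy0
    have h1 := C.seq_eq_zero_comm _ _ h0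
    have h2 := C.comm_compl _ _ h1
    rw [C.compl_compl] at h2
    have h3 := seq_add_seq_compl (C := C) (c i) p
    rw [h1.trans h0, toExt_zero, add_zero] at h3
    have h4 := toExt_injective h3
    exact ⟨h2.symm.trans h4, h4⟩
  have hci : ∀ i, C.toExt (C.seq (c i) (C.smul (1 / 2) x)) +
      C.toExt (C.smul (1 / 2) (C.seq (c i) p)) = C.toExt (C.smul (f i) (c i)) := by
    intro i
    rw [← hc.seq_combo hf i, ← (isAdditive_seq (c i)).add hy,
      C.seq_smul (1 / 2) (c i) p (by norm_num) (by norm_num)]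
  have hnull : ∀ i, f i = 0 → C.seq p (c i) = C.zero := by
    intro i hi
    have h1 := hci i
    rw [hi, zero_smul, toExt_zero, add_comm] at h1
    have h2 := eq_zero_of_smul_eq_zero (by norm_num) (by norm_num) (eq_zero_of_add_eq_zero h1)
    exact (C.seq_eq_zero_comm _ _ h2).trans h2
  have hge : ∀ i, f i ≠ 0 → 1 / 2 ≤ f i := by
    intro i hi
    by_contra hlt
    push Not at hlt
    have h1 := hci i
    rw [(hsupp i hi).2] at h1
    have h2 := toExt_smul_add (C := C) (hf.1 i).1 (sub_nonneg.2 hlt.le) (by norm_num) (c i)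
    rw [add_sub_cancel] at h2
    rw [← h2, add_left_comm] at h1
    have h3 := add_left_cancel_ext h1 (add_zero _)
    rw [add_comm] at h3
    exact (hc.1 i).2.1 (eq_zero_of_smul_eq_zero (by linarith) (by linarith [(hf.1 i).1])
      (eq_zero_of_add_eq_zero h3))
  have hsp : ∑ i with f i ≠ 0, C.toExt (c i) = C.toExt p := by
    have h1 := (isAdditive_seq (C := C) p).sum hc.2
    rw [seq_one] at h1
    rw [← h1, Finset.sum_filter]
    refine Finset.sum_congr rfl fun i _ => ?_
    split_ifs with hi
    · rw [(hsupp i hi).1]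
    · rw [hnull i (not_not.1 hi), toExt_zero]
  have hg : ∀ i ∈ Finset.univ.filter (fun i => f i ≠ 0), 0 ≤ 2 * f i - 1 ∧ 2 * f i - 1 ≤ 1 := by
    intro i hi
    have := hge i (Finset.mem_filter.1 hi).2
    exact ⟨by linarith, by linarith [(hf.1 i).2]⟩
  refine ⟨n, c, Finset.univ.filter (fun i => f i ≠ 0), fun i => 2 * f i - 1,
    fun i hi => ⟨hc.1 i, hg i hi⟩, hsp, ?_⟩
  obtain ⟨w, hw⟩ := exists_sum_eq_of_le (x := fun i => C.smul (2 * f i - 1) (c i))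
    (fun i hi => smul_le (hg i hi).1 (hg i hi).2 (c i)) hsp
  rw [hw]
  congr 1
  apply smul_half_injective
  apply toExt_injective
  refine add_left_cancel_ext (x := C.toExt (C.smul (1 / 2) p)) (s := y) ?_
    ((add_comm _ _).trans hy)
  rw [← hhalf.sum hsp, ← hhalf.sum hw, ← Finset.sum_add_distrib, ← hf.2, Finset.sum_filter]
  refine Finset.sum_congr rfl fun i _ => ?_
  split_ifs with hi
  · have hi' := hg i (Finset.mem_filter.2 ⟨Finset.mem_univ i, hi⟩)
    rw [C.smul_smul _ _ _ (by norm_num) (by norm_num) hi'.1 hi'.2,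
      toExt_smul_add (by norm_num) (by linarith) (by linarith)]
    congr 2
    ring
  · rw [not_not.1 hi, zero_smul, toExt_zero]

theorem Spectral.exists_common_frame (h : C.Spectral) {a b : E}
    (hab : C.seq a b = C.seq b a) :
    ∃ (ι : Type) (_ : Fintype ι) (c : ι → E) (f g : ι → ℝ),
      C.IsFrame c ∧ C.IsCombo c f a ∧ C.IsCombo c g b := by
  classical
  obtain ⟨n, c, f, hc, hf⟩ := h.exists_frame b
  have hcomm : C.ComboCommutes c a f := ⟨b, hf, hab⟩
  have hproj : ∀ t : Finset.univ.image f, ∃ p,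
      C.IsCombo c (fun i => if f i = t then 1 else 0) p ∧ C.seq a p = C.seq p a :=
    fun t => hcomm.levelSet hc t.2
  choose p hp hap using hproj
  have hpp : ∀ t, C.seq (p t) (p t) = p t := by
    intro t
    have h1 := hc.combo_mul (hp t) (hp t)
    refine h1.unique ?_
    convert hp t using 2 with i
    split_ifs <;> norm_num
  choose n' d s g hd hdp hda using fun t => h.exists_frame_of_le (hpp t) (seq_le (p t) a)
  have hmem : ∀ t : Finset.univ.image f, 0 ≤ (t : ℝ) ∧ (t : ℝ) ≤ 1 := by
    rintro ⟨t, ht⟩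
    obtain ⟨i, -, rfl⟩ := Finset.mem_image.1 ht
    exact hf.1 i
  have hlevel : ∀ ψ : ℝ → E → E, (∀ t : Finset.univ.image f, C.IsAdditive (ψ t)) →
      ∑ t : Finset.univ.image f, C.toExt (ψ t (p t)) = ∑ i, C.toExt (ψ (f i) (c i)) := by
    intro ψ hψ
    rw [Finset.sum_congr rfl fun t _ => ((hψ t).sum (hp t).2).symm, Finset.sum_comm]
    refine Finset.sum_congr rfl fun i _ => ?_
    rw [Finset.sum_eq_single ⟨f i, Finset.mem_image_of_mem f (Finset.mem_univ i)⟩]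
    · simp only [if_true, C.one_smul]
    · intro t _ ht
      have hne : f i ≠ t := fun e => ht (Subtype.ext e.symm)
      simp only [if_neg hne]
      rw [zero_smul, (hψ t).map_zero, toExt_zero]
    · intro h
      exact absurd (Finset.mem_univ _) h
  have hp1 : ∑ t, C.toExt (p t) = C.toExt C.one :=
    (hlevel (fun _ => id) fun _ _ _ h => ⟨h, rfl⟩).trans hc.2
  have hpb : ∑ t : Finset.univ.image f, C.toExt (C.smul t (p t)) = C.toExt b :=
    (hlevel C.smul fun t => isAdditive_smul (hmem t).1 (hmem t).2).trans hf.2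
  have hpa : ∑ t, C.toExt (C.seq (p t) a) = C.toExt a := by
    have h1 := (isAdditive_seq (C := C) a).sum hp1
    rw [seq_one] at h1
    rw [← h1]
    exact Finset.sum_congr rfl fun t _ => by rw [hap t]
  refine ⟨Σ t, s t, inferInstance, fun x => d x.1 x.2, fun x => g x.1 x.2, fun x => x.1,
    ⟨fun x => (hd x.1 x.2 x.2.2).1, ?_⟩, ⟨fun x => (hd x.1 x.2 x.2.2).2, ?_⟩,
    ⟨fun x => hmem x.1, ?_⟩⟩
  · rw [Fintype.sum_sigma, ← hp1]
    refine Finset.sum_congr rfl fun t _ => ?_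
    exact (Finset.sum_coe_sort (s t) fun i => C.toExt (d t i)).trans (hdp t)
  · rw [Fintype.sum_sigma, ← hpa]
    refine Finset.sum_congr rfl fun t _ => ?_
    exact (Finset.sum_coe_sort (s t) fun i => C.toExt (C.smul (g t i) (d t i))).trans (hda t)
  · rw [Fintype.sum_sigma, ← hpb]
    refine Finset.sum_congr rfl fun t _ => ?_
    exact (Finset.sum_coe_sort (s t) fun i => C.toExt (C.smul t (d t i))).trans
      ((isAdditive_smul (hmem t).1 (hmem t).2).sum (hdp t))

theorem IsContextFun.isFrame {n : ℕ} {c : Fin n → E} (hc : C.IsContextFun c) : C.IsFrame c :=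
  ⟨hc.2.1, sumList_ofFn_iff.1 hc.2.2⟩

theorem IsContext.comm {A : Set E} (hA : C.IsContext A) {x y : E} (hx : x ∈ A) (hy : y ∈ A) :
    C.seq x y = C.seq y x := by
  obtain ⟨n, c, hc, rfl⟩ := hA
  obtain ⟨i, rfl⟩ := hx
  obtain ⟨j, rfl⟩ := hy
  exact hc.isFrame.comm i j

theorem InSpan.comm {A : Set E} {a b : E} (hb : C.InSpan A b)
    (h : ∀ x ∈ A, C.seq a x = C.seq x a) : C.seq a b = C.seq b a := by
  obtain ⟨n, c, f, -, rfl, hf, hsum⟩ := hb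
  exact comm_sum (fun i _ => comm_smul (hf i).1 (hf i).2 (h _ ⟨i, rfl⟩))
    (sumList_ofFn_iff.1 hsum)

theorem IsFrame.exists_context {ι : Type*} [Fintype ι] {c : ι → E} (hc : C.IsFrame c) :
    C.IsContext (Set.range c) ∧ ∀ f x, C.IsCombo c f x → C.InSpan (Set.range c) x := by
  let e := (Fintype.equivFin ι).symm
  have hctx : C.IsContextFun (c ∘ e) :=
    ⟨hc.injective.comp e.injective, fun i => hc.1 (e i),
      sumList_ofFn_iff.2 ((e.sum_comp fun i => C.toExt (c i)).trans hc.2)⟩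
  have hrange : Set.range (c ∘ e) = Set.range c := e.surjective.range_comp c
  refine ⟨⟨_, _, hctx, hrange⟩, fun f x hx => ⟨_, _, f ∘ e, hctx, hrange,
    fun i => hx.1 (e i), sumList_ofFn_iff.2 ?_⟩⟩
  exact (e.sum_comp fun i => C.toExt (C.smul (f i) (c i))).trans hx.2

end Spectral

end COSEA

/-- `a ∣ b` iff `a, b` lie in `E(A)` for some common context `A`. -/
theorem comm_iff_common_context {E : Type u} (C : COSEA E)
    (hFD : C.FinDim) (hSp : C.Spectral) (a b : E) :
    C.seq a b = C.seq b a ↔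
      ∃ A : Set E, C.IsContext A ∧ C.InSpan A a ∧ C.InSpan A b := by
  constructor
  · intro hab
    obtain ⟨ι, _, c, f, g, hc, hf, hg⟩ := hSp.exists_common_frame hab
    obtain ⟨hA, hspan⟩ := hc.exists_context
    exact ⟨_, hA, hspan f a hf, hspan g b hg⟩
  · rintro ⟨A, hA, ha, hb⟩
    exact hb.comm fun x hx => (ha.comm fun y hy => hA.comm hx hy).symm
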